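/- (Necessitation is derivable in S3+(4)) Let S4 denote the system S1+SP extended by the axiom schemes (3) □(φ→ψ)→□(□φ→□ψ) and (4) □φ→□□φ, where the rule AN applies to all axioms of the forms (i)–(iii), (3) and (4). Then the full Necessitation Rule is derivable in S4: for every modal formula ψ, if ψ is a theorem of S4, then □ψ is a theorem of S4. -/

import Mathlib

/-- Modal formulas over countably many propositional variables x₀, x₁, …. -/
inductive Fm : Type
  | var : ℕ → Fm
  | neg : Fm → Fm
  | imp : Fm → Fm → Fm
  | box : Fm → Fm
deriving DecidableEq

namespace Fm

/-- ⊤ := x₀ → x₀ -/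
def top : Fm := imp (var 0) (var 0)

/-- φ ∧ ψ := ¬(φ → ¬ψ) -/
def conj (φ ψ : Fm) : Fm := neg (imp φ (neg ψ))

/-- φ ↔ ψ := (φ → ψ) ∧ (ψ → φ) -/
def biimp (φ ψ : Fm) : Fm := conj (imp φ ψ) (imp ψ φ)

/-- strict equivalence: φ ≡ ψ := □(φ → ψ) ∧ □(ψ → φ) -/
def equiv (φ ψ : Fm) : Fm := conj (box (imp φ ψ)) (box (imp ψ φ))

/-- φ[x := ψ]: substitution of ψ for all occurrences of the variable x in φ. -/
def subst (φ : Fm) (x : ℕ) (ψ : Fm) : Fm :=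
  match φ with
  | var y => if y = x then ψ else var y
  | neg χ => neg (subst χ x ψ)
  | imp χ δ => imp (subst χ x ψ) (subst δ x ψ)
  | box χ => box (subst χ x ψ)

/-- Propositional (two-valued) evaluation of a modal formula, treating
variables and boxed formulas as atoms. -/
def pEval (v : Fm → Bool) : Fm → Bool
  | var n => v (var n)
  | neg φ => !(pEval v φ)
  | imp φ ψ => !(pEval v φ) || pEval v ψ
  | box φ => v (box φ)

/-- φ has the form of a propositional tautology, i.e. φ is a substitution
instance of a propositional tautology. -/
def isTautInstance (φ : Fm) : Prop := ∀ v : Fm → Bool, pEval v φ = true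

/-- The axioms (i)–(iii) of Lewis system S1 (Lemmon-style). -/
inductive S1Axiom : Fm → Prop
  | taut {φ} : isTautInstance φ → S1Axiom φ
  | ax2 (φ) : S1Axiom (imp (box φ) φ)
  | ax3 (φ ψ χ) :
      S1Axiom (imp (conj (box (imp φ ψ)) (box (imp ψ χ))) (box (imp φ χ)))

/-- The identity axioms (iv)–(vi), i.e. the Substitution Principle SP. -/
inductive SPAxiom : Fm → Prop
  | ax4 (φ ψ) : SPAxiom (imp (equiv φ ψ) (equiv (neg φ) (neg ψ)))
  | ax5 (φ ψ φ' ψ') :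
      SPAxiom (imp (conj (equiv φ ψ) (equiv φ' ψ'))
        (equiv (imp φ φ') (imp ψ ψ')))
  | ax6 (φ ψ) : SPAxiom (imp (equiv φ ψ) (equiv (box φ) (box ψ)))

/-- Derivability in S1+SP from a set Φ of premises: axioms (i)–(vi),
modus ponens, and Axiom Necessitation AN restricted to axioms (i)–(iii). -/
inductive S1SP : Set Fm → Fm → Prop
  | prem {Φ φ} : φ ∈ Φ → S1SP Φ φ
  | axm {Φ φ} : S1Axiom φ → S1SP Φ φ
  | spAxm {Φ φ} : SPAxiom φ → S1SP Φ φ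
  | mp {Φ φ ψ} : S1SP Φ (imp φ ψ) → S1SP Φ φ → S1SP Φ ψ
  | an {Φ φ} : S1Axiom φ → S1SP Φ (box φ)

end Fm

namespace Fm

/-- The axioms of S4 = S1+SP+(3)+(4) to which rule AN applies:
the S1 axioms (i)–(iii) together with (3) □(φ→ψ)→□(□φ→□ψ) and
(4) □φ→□□φ. -/
inductive S4ANAxiom : Fm → Prop
  | s1 {φ} : S1Axiom φ → S4ANAxiom φ
  | ax3 (φ ψ) : S4ANAxiom (imp (box (imp φ ψ)) (box (imp (box φ) (box ψ))))
  | ax4 (φ) : S4ANAxiom (imp (box φ) (box (box φ)))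

/-- Theorems of S4 = S1+SP+(3)+(4): axioms (i)–(vi),(3),(4), modus ponens, and
rule AN applicable to the axioms (i)–(iii),(3),(4) but not to (iv)–(vi). -/
inductive S4 : Fm → Prop
  | axm {φ} : S4ANAxiom φ → S4 φ
  | spAxm {φ} : SPAxiom φ → S4 φ
  | mp {φ ψ} : S4 (imp φ ψ) → S4 φ → S4 ψ
  | an {φ} : S4ANAxiom φ → S4 (box φ)

end Fm

namespace Fm

theorem n_mp {a b : Fm} (h : S4 (box (imp a b))) (k : S4 (box a)) : S4 (box b) :=
  S4.mp (S4.mp (S4.axm (.s1 (.ax2 _))) (S4.mp (S4.axm (.ax3 a b)) h)) k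

theorem n_nec {a : Fm} (h : S4 (box a)) : S4 (box (box a)) :=
  S4.mp (S4.axm (.ax4 a)) h

theorem n_taut {a : Fm} (h : isTautInstance a) : S4 (box a) := S4.an (.s1 (.taut h))

theorem n_comp {a b c : Fm} (h : S4 (box (imp a b))) (k : S4 (box (imp b c))) :
    S4 (box (imp a c)) := by
  refine n_mp (n_mp (n_taut (a := imp (imp a b) (imp (imp b c) (imp a c))) ?_) h) k
  intro v
  simp only [pEval]
  cases pEval v a <;> cases pEval v b <;> cases pEval v c <;> rfl

theorem n_K (a b : Fm) : S4 (box (imp (box (imp a b)) (imp (box a) (box b)))) :=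
  n_comp (S4.an (.ax3 a b)) (S4.an (.s1 (.ax2 _)))

theorem n_mono {a b : Fm} (h : isTautInstance (imp a b)) : S4 (box (imp (box a) (box b))) :=
  n_mp (n_K a b) (n_nec (n_taut h))

theorem n_mono2 {a b c : Fm} (h : isTautInstance (imp a (imp b c))) :
    S4 (box (imp (box a) (imp (box b) (box c)))) :=
  n_comp (n_mono h) (n_K b c)

theorem n_sp {a : Fm} (h : SPAxiom a) : S4 (box a) := by
  cases h with
  | ax4 a b =>
    have h1 : ∀ a b : Fm, S4 (box (imp (box (imp a b)) (box (imp (neg b) (neg a))))) := by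
      intro a b
      apply n_mono
      intro v
      simp only [pEval]
      cases pEval v a <;> cases pEval v b <;> rfl
    refine n_mp (n_mp (n_taut ?_) (h1 a b)) (h1 b a)
    intro v
    simp only [pEval, equiv, conj]
    generalize v _ = p, v _ = q, v _ = r, v _ = s
    revert p q r s; decide
  | ax5 a b c d =>
    have h1 : ∀ a b c d : Fm, S4 (box (imp (box (imp b a)) (imp (box (imp c d))
        (box (imp (imp a c) (imp b d)))))) := by
      intro a b c d
      apply n_mono2
      intro v
      simp only [pEval]
      cases pEval v a <;> cases pEval v b <;> cases pEval v c <;> cases pEval v d <;> rfl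
    refine n_mp (n_mp (n_taut ?_) (h1 a b c d)) (h1 b a d c)
    intro v
    simp only [pEval, equiv, conj]
    generalize v _ = p, v _ = q, v _ = r, v _ = s, v _ = t, v _ = u
    revert p q r s t u; decide
  | ax6 a b =>
    refine n_mp (n_mp (n_taut ?_) (S4.an (.ax3 a b))) (S4.an (.ax3 b a))
    intro v
    simp only [pEval, equiv, conj]
    generalize v _ = p, v _ = q, v _ = r, v _ = s
    revert p q r s; decide

end Fm

open Fm in
/-- The full Necessitation Rule is derivable in S4 = S3+(4). -/
theorem necessitation_in_S4 (ψ : Fm) (h : S4 ψ) : S4 (box ψ) := by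
  induction h with
  | axm h => exact S4.an h
  | spAxm h => exact n_sp h
  | mp _ _ h k => exact n_mp h k
  | an h => exact n_nec (S4.an h)
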